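/- arXiv:2602.00941 — 3 statements merged into one kernel-verified Lean document; each statement's English description precedes it below -/
import Mathlib

section
/- Let K be a compact subset of ℝ^d and let σ : ℝ → ℝ be continuous and not equal to any polynomial. Then the set H of single-hidden-layer neural networks, i.e. functions of the form x ↦ ∑_{i=1}^m a_i · σ(⟨w_i, x⟩ + b_i) with m ∈ ℕ, a_i ∈ ℝ, w_i ∈ ℝ^d, b_i ∈ ℝ, is dense in the space C(K) of continuous real-valued functions on K with respect to the uniform norm: for every continuous f : K → ℝ and every ε > 0 there exists h ∈ H with sup_{x ∈ K} |f(x) − h(x)| < ε. -/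
open scoped RealInnerProductSpace BigOperators
open MeasureTheory Filter Topology
open scoped ContDiff Convolution

/-- The derivative in `s` of `h * g (s • ℓ + b)`, as a curve in `C(X, ℝ)`. -/
theorem hasDerivAt_mul_comp_affine {X : Type*} [TopologicalSpace X] [CompactSpace X]
    (h ℓ : C(X, ℝ)) (g g' : C(ℝ, ℝ)) (hg : ∀ t, HasDerivAt g (g' t) t) (b c : ℝ) :
    HasDerivAt (fun s : ℝ => h * g.comp (s • ℓ + .const X b))
      (h * ℓ * g'.comp (c • ℓ + .const X b)) c := by
  set v : ℝ → C(X, ℝ) := fun s => h * ℓ * g'.comp (s • ℓ + .const X b) with hv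
  have hvc : Continuous v := by fun_prop
  have key : ∀ s : ℝ, h * g.comp (s • ℓ + .const X b) =
      (∫ t in (0 : ℝ)..s, v t) + h * g.comp (.const X b) := by
    intro s
    ext x
    have h1 : (∫ t in (0 : ℝ)..s, v t) x = ∫ t in (0 : ℝ)..s, v t x :=
      ((ContinuousMap.evalCLM ℝ x).intervalIntegral_comp_comm (hvc.intervalIntegrable 0 s)).symm
    have h2 : ∫ t in (0 : ℝ)..s, v t x =
        h x * g (s * ℓ x + b) - h x * g (0 * ℓ x + b) := by
      apply intervalIntegral.integral_eq_sub_of_hasDerivAt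
        (f := fun t => h x * g (t * ℓ x + b))
      · intro t _
        have h3 : HasDerivAt (fun t : ℝ => t * ℓ x + b) (ℓ x) t := by
          simpa using ((hasDerivAt_id t).mul_const (ℓ x)).add_const b
        refine (((hg _).comp t h3).const_mul (h x)).congr_deriv ?_
        simp [hv]
        ring
      · exact ((ContinuousMap.evalCLM ℝ x).continuous.comp hvc).intervalIntegrable 0 s
    simp only [ContinuousMap.add_apply, h1, h2]
    simp
  rw [funext key]
  exact (intervalIntegral.integral_hasDerivAt_right (hvc.intervalIntegrable 0 c)
    hvc.aestronglyMeasurable.stronglyMeasurableAtFilter hvc.continuousAt).add_const _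

/-- A closed subspace contains the derivatives of the curves that lie in it. -/
theorem Submodule.mem_of_hasDerivAt {F : Type*} [NormedAddCommGroup F] [NormedSpace ℝ F]
    (M : Submodule ℝ F) (hM : IsClosed (M : Set F)) {u : ℝ → F} {u' : F} {c : ℝ}
    (hu : HasDerivAt u u' c) (hmem : ∀ s, u s ∈ M) : u' ∈ M := by
  have h := range_deriv_subset_closure_span_image u dense_univ (Set.mem_range_self c)
  rw [hu.deriv] at h
  refine hM.closure_subset_iff.2 ?_ h
  exact Submodule.span_le.2 (by rintro _ ⟨s, -, rfl⟩; exact hmem s)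

/-- If a closed subspace of `C(X, ℝ)` contains all `g (c • ℓ + b)`, with `g` smooth, then it contains
all `ℓ ^ n * g⁽ⁿ⁾ (c • ℓ + b)`. -/
theorem pow_mul_iteratedDeriv_comp_affine_mem {X : Type*} [TopologicalSpace X] [CompactSpace X]
    (M : Submodule ℝ C(X, ℝ)) (hM : IsClosed (M : Set C(X, ℝ))) (ℓ : C(X, ℝ))
    (g : C(ℝ, ℝ)) (hg : ContDiff ℝ ∞ g) (hmem : ∀ c b : ℝ, g.comp (c • ℓ + .const X b) ∈ M)
    (n : ℕ) (c b : ℝ) :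
    ℓ ^ n * (⟨iteratedDeriv n g, hg.continuous_iteratedDeriv n (mod_cast le_top)⟩ : C(ℝ, ℝ)).comp
      (c • ℓ + .const X b) ∈ M := by
  induction n generalizing c with
  | zero =>
    convert hmem c b using 1
    ext x
    simp
  | succ n ih =>
    refine M.mem_of_hasDerivAt hM ?_ ih (c := c)
    rw [pow_succ]
    refine hasDerivAt_mul_comp_affine _ _ _ _ (fun t => ?_) b c
    simp only [ContinuousMap.coe_mk, iteratedDeriv_succ]
    exact ((hg.differentiable_iteratedDeriv n (mod_cast WithTop.coe_lt_top n)) t).hasDerivAt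

/-- A smooth function whose `n`-th derivative vanishes is a polynomial of degree less than `n`. -/
theorem mem_span_pow_of_iteratedDeriv_eq_zero {g : ℝ → ℝ} (hg : ContDiff ℝ ∞ g) {n : ℕ}
    (h0 : ∀ t, iteratedDeriv n g t = 0) :
    g ∈ Submodule.span ℝ (Set.range fun (k : Fin n) (x : ℝ) => x ^ (k : ℕ)) := by
  rcases n with _ | n
  · have : g = 0 := by ext t; simpa using h0 t
    simp [this]
  have key : g = ∑ k : Fin (n + 1), (((k : ℕ).factorial : ℝ)⁻¹ * iteratedDeriv k g 0) •
      fun x : ℝ => x ^ (k : ℕ) := by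
    ext x
    rcases eq_or_ne (0 : ℝ) x with rfl | hx
    · simp [Fin.sum_univ_succ]
    have hU := uniqueDiffOn_uIcc hx
    have hd : ∀ k : ℕ, ∀ t ∈ Set.uIcc 0 x,
        iteratedDerivWithin k g (Set.uIcc 0 x) t = iteratedDeriv k g t := fun k t ht =>
      iteratedDerivWithin_eq_iteratedDeriv hU
        (hg.contDiffAt.of_le (mod_cast le_top)) ht
    have hT := taylor_integral_remainder (n := n) (x₀ := 0) (x := x)
      (hg.contDiffOn.of_le (mod_cast le_top))
    rw [intervalIntegral.integral_congr (g := fun _ => (0 : ℝ))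
      (fun t ht => by simp [hd _ t ht, h0]), intervalIntegral.integral_zero, sub_eq_zero,
      taylor_within_apply] at hT
    rw [hT, Finset.sum_range, Finset.sum_apply]
    refine Finset.sum_congr rfl fun k _ => ?_
    rw [hd _ 0 Set.left_mem_uIcc]
    simp
    ring
  rw [key]
  exact Submodule.sum_mem _ fun k _ => Submodule.smul_mem _ _ (Submodule.subset_span ⟨k, rfl⟩)

/-- A closed subspace contains the integrals of the functions with values in it. -/
theorem Submodule.integral_mem_of_isClosed {α F : Type*} [MeasurableSpace α] {μ : Measure α}
    [NormedAddCommGroup F] [NormedSpace ℝ F] [CompleteSpace F] (M : Submodule ℝ F)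
    (hM : IsClosed (M : Set F)) {v : α → F} (hv : Integrable v μ) (hmem : ∀ t, v t ∈ M) :
    ∫ t, v t ∂μ ∈ M := by
  have : IsClosed (M : Set F) := hM
  rw [← M.ker_mkQ, LinearMap.mem_ker]
  change M.mkQL (∫ t, v t ∂μ) = 0
  rw [← M.mkQL.integral_comp_comm hv]
  exact integral_eq_zero_of_ae (.of_forall fun t => (Submodule.Quotient.mk_eq_zero M).2 (hmem t))

/-- A closed subspace of `C(X, ℝ)` that contains all `σ (c • ℓ + b)` also contains the functions
obtained by mollifying `σ`. -/
theorem convolution_comp_affine_mem {X : Type*} [TopologicalSpace X] [CompactSpace X]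
    (M : Submodule ℝ C(X, ℝ)) (hM : IsClosed (M : Set C(X, ℝ))) (ℓ : C(X, ℝ))
    (σ : C(ℝ, ℝ)) (hmem : ∀ c b : ℝ, σ.comp (c • ℓ + .const X b) ∈ M)
    (φ : ContDiffBump (0 : ℝ)) (g : C(ℝ, ℝ))
    (hg : ⇑g = φ.normed volume ⋆[ContinuousLinearMap.lsmul ℝ ℝ, volume] σ) (c b : ℝ) :
    g.comp (c • ℓ + .const X b) ∈ M := by
  set v : ℝ → C(X, ℝ) := fun t => φ.normed volume t • σ.comp (c • ℓ + .const X (b - t)) with hv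
  have hφ : Continuous (φ.normed volume) := φ.continuous_normed
  have hvc : Continuous v := by
    have : Continuous fun t : ℝ => ContinuousMap.const X (b - t) :=
      ContinuousMap.continuous_const'.comp (by fun_prop)
    fun_prop
  have hvi : Integrable v :=
    hvc.integrable_of_hasCompactSupport φ.hasCompactSupport_normed.smul_right
  have heq : g.comp (c • ℓ + .const X b) = ∫ t, v t := by
    ext x
    have h1 : (∫ t, v t) x = ∫ t, v t x :=
      ((ContinuousMap.evalCLM ℝ x).integral_comp_comm hvi).symm
    rw [h1]
    simp [hg, hv, convolution_def, add_sub_assoc]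
  rw [heq]
  exact M.integral_mem_of_isClosed hM hvi fun t => M.smul_mem _ (hmem _ _)

/-- A closed subspace of `C(X, ℝ)` that contains all `σ (c • ℓ + b)`, with `σ` continuous and not a
polynomial, contains all powers of `ℓ`. -/
theorem pow_mem_of_comp_affine_mem {X : Type*} [TopologicalSpace X] [CompactSpace X]
    (M : Submodule ℝ C(X, ℝ)) (hM : IsClosed (M : Set C(X, ℝ))) (ℓ : C(X, ℝ))
    (σ : C(ℝ, ℝ)) (hσ : ∀ p : Polynomial ℝ, ∃ x : ℝ, σ x ≠ p.eval x)
    (hmem : ∀ c b : ℝ, σ.comp (c • ℓ + .const X b) ∈ M) (n : ℕ) : ℓ ^ n ∈ M := by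
  by_contra hn
  set W : Submodule ℝ (ℝ → ℝ) :=
    Submodule.span ℝ (Set.range fun (k : Fin n) (x : ℝ) => x ^ (k : ℕ))
  have hconv : ∀ φ : ContDiffBump (0 : ℝ),
      (φ.normed volume ⋆[ContinuousLinearMap.lsmul ℝ ℝ, volume] σ) ∈ W := by
    intro φ
    have hg : ContDiff ℝ ∞ (φ.normed volume ⋆[ContinuousLinearMap.lsmul ℝ ℝ, volume] σ) :=
      φ.hasCompactSupport_normed.contDiff_convolution_left _ φ.contDiff_normed
        σ.continuous.locallyIntegrable
    refine mem_span_pow_of_iteratedDeriv_eq_zero hg fun b => ?_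
    by_contra hb
    have h := pow_mul_iteratedDeriv_comp_affine_mem M hM ℓ ⟨_, hg.continuous⟩ hg
      (convolution_comp_affine_mem M hM ℓ σ hmem φ _ rfl) n 0 b
    apply hn
    convert M.smul_mem (iteratedDeriv n
      (φ.normed volume ⋆[ContinuousLinearMap.lsmul ℝ ℝ, volume] σ) b)⁻¹ h using 1
    ext x
    simp
    field_simp
  have hfin : FiniteDimensional ℝ W := FiniteDimensional.span_of_finite ℝ (Set.finite_range _)
  have hσW : (σ : ℝ → ℝ) ∈ W := by
    let φ : ℕ → ContDiffBump (0 : ℝ) := fun i =>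
      ⟨1 / (i + 1) / 2, 1 / (i + 1), by positivity, half_lt_self (by positivity)⟩
    refine W.closed_of_finiteDimensional.mem_of_tendsto (b := atTop)
      (f := fun i => (φ i).normed volume ⋆[ContinuousLinearMap.lsmul ℝ ℝ, volume] σ) ?_
      (Eventually.of_forall fun i => hconv (φ i))
    exact tendsto_pi_nhds.2 fun x => ContDiffBump.convolution_tendsto_right_of_continuous
      tendsto_one_div_add_atTop_nhds_zero_nat σ.continuous x
  obtain ⟨a, ha⟩ := (Submodule.mem_span_range_iff_exists_fun ℝ).1 hσW
  obtain ⟨x, hx⟩ := hσ (∑ k : Fin n, Polynomial.C (a k) * Polynomial.X ^ (k : ℕ))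
  apply hx
  rw [← ha]
  simp [Polynomial.eval_finsetSum]

/-- A closed subspace containing all powers of `a` contains `exp a`. -/
theorem exp_mem_of_pow_mem {A : Type*} [NormedRing A] [NormedAlgebra ℝ A] [CompleteSpace A]
    (M : Submodule ℝ A) (hM : IsClosed (M : Set A)) {a : A} (ha : ∀ n : ℕ, a ^ n ∈ M) :
    NormedSpace.exp a ∈ M :=
  hM.mem_of_tendsto (NormedSpace.exp_series_hasSum_exp' (𝕂 := ℝ) a)
    (Eventually.of_forall fun _ => M.sum_mem fun n _ => M.smul_mem _ (ha n))

/-- The exponentials of an additive submonoid of `C(X, ℝ)` that separates points span a dense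
subspace. -/
theorem span_exp_topologicalClosure_eq_top {X : Type*} [TopologicalSpace X] [CompactSpace X]
    (L : AddSubmonoid C(X, ℝ)) (hL : ∀ x y : X, x ≠ y → ∃ ℓ ∈ L, ℓ x ≠ ℓ y) :
    (Submodule.span ℝ (NormedSpace.exp '' (L : Set C(X, ℝ)))).topologicalClosure = ⊤ := by
  let S : Submonoid C(X, ℝ) :=
    { carrier := NormedSpace.exp '' (L : Set C(X, ℝ))
      one_mem' := ⟨0, L.zero_mem, NormedSpace.exp_zero⟩
      mul_mem' := by
        rintro _ _ ⟨a, ha, rfl⟩ ⟨b, hb, rfl⟩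
        exact ⟨a + b, L.add_mem ha hb, NormedSpace.exp_add_of_commute (Commute.all a b)⟩ }
  have hS : Subalgebra.toSubmodule (Algebra.adjoin ℝ (S : Set C(X, ℝ))) =
      Submodule.span ℝ (NormedSpace.exp '' (L : Set C(X, ℝ))) := by
    rw [Algebra.adjoin_eq_span, Submonoid.closure_eq]; rfl
  have hsep : (Algebra.adjoin ℝ (S : Set C(X, ℝ))).SeparatesPoints := by
    intro x y hxy
    obtain ⟨ℓ, hℓ, hne⟩ := hL x y hxy
    refine ⟨_, ⟨NormedSpace.exp ℓ, Algebra.subset_adjoin ⟨ℓ, hℓ, rfl⟩, rfl⟩, ?_⟩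
    have hexp : ∀ z, NormedSpace.exp ℓ z = Real.exp (ℓ z) := fun z => by
      rw [Real.exp_eq_exp_ℝ]
      exact NormedSpace.map_exp (ContinuousMap.evalAlgHom ℝ ℝ z)
        (ContinuousMap.evalCLM ℝ z).continuous ℓ
    simpa [hexp] using hne
  have htop := ContinuousMap.subalgebra_topologicalClosure_eq_top_of_separatesPoints _ hsep
  rw [← hS]
  apply SetLike.coe_injective
  simpa using congrArg (SetLike.coe) htop

/-- Universal Approximation Theorem: single-hidden-layer neural networks with a
continuous non-polynomial activation are dense in `C(K)` for compact `K ⊆ ℝ^d`. -/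
theorem universal_approximation
    (d : ℕ) (K : Set (EuclideanSpace ℝ (Fin d))) (hK : IsCompact K)
    (σ : ℝ → ℝ) (hσ_cont : Continuous σ)
    (hσ_nonpoly : ∀ p : Polynomial ℝ, ∃ x : ℝ, σ x ≠ p.eval x)
    (f : K → ℝ) (hf : Continuous f) (ε : ℝ) (hε : 0 < ε) :
    ∃ (m : ℕ) (a : Fin m → ℝ) (w : Fin m → EuclideanSpace ℝ (Fin d)) (b : Fin m → ℝ),
      ∀ x : K, |f x - ∑ i : Fin m, a i * σ (⟪w i, (x : EuclideanSpace ℝ (Fin d))⟫ + b i)| < ε := by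
  have : CompactSpace K := isCompact_iff_compactSpace.1 hK
  let lin : EuclideanSpace ℝ (Fin d) →+ C(K, ℝ) :=
    { toFun := fun w => ⟨fun x => ⟪w, (x : EuclideanSpace ℝ (Fin d))⟫, by fun_prop⟩
      map_zero' := by ext; simp
      map_add' := fun v w => by ext; simp [inner_add_left] }
  let neuron : EuclideanSpace ℝ (Fin d) × ℝ → C(K, ℝ) := fun p =>
    (⟨σ, hσ_cont⟩ : C(ℝ, ℝ)).comp (lin p.1 + .const K p.2)
  set N := Submodule.span ℝ (Set.range neuron)
  have hexp : NormedSpace.exp '' (AddMonoidHom.mrange lin : Set C(K, ℝ)) ⊆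
      N.topologicalClosure := by
    rintro _ ⟨_, ⟨w, rfl⟩, rfl⟩
    refine exp_mem_of_pow_mem _ N.isClosed_topologicalClosure
      (pow_mem_of_comp_affine_mem _ N.isClosed_topologicalClosure _ ⟨σ, hσ_cont⟩ hσ_nonpoly
        fun c b => N.le_topologicalClosure (Submodule.subset_span ⟨(c • w, b), ?_⟩))
    ext x
    simp [neuron, lin, inner_smul_left]
  have htop : N.topologicalClosure = ⊤ := by
    rw [eq_top_iff, ← span_exp_topologicalClosure_eq_top (AddMonoidHom.mrange lin)]
    · exact Submodule.topologicalClosure_minimal _ (Submodule.span_le.2 hexp)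
        N.isClosed_topologicalClosure
    · intro x y hxy
      refine ⟨_, ⟨(x - y : EuclideanSpace ℝ (Fin d)), rfl⟩, fun h => hxy (Subtype.ext ?_)⟩
      rw [← sub_eq_zero, ← inner_self_eq_zero (𝕜 := ℝ), inner_sub_right, sub_eq_zero]
      exact h
  have hfmem : (⟨f, hf⟩ : C(K, ℝ)) ∈ closure (N : Set C(K, ℝ)) := by
    rw [← Submodule.topologicalClosure_coe, htop]; trivial
  obtain ⟨h, hh, hdist⟩ := Metric.mem_closure_iff.1 hfmem ε hε
  obtain ⟨m, a, g, rfl⟩ := Submodule.mem_span_set'.1 hh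
  choose p hp using fun i => (g i).2
  refine ⟨m, a, fun i => (p i).1, fun i => (p i).2, fun x => ?_⟩
  have hx := (ContinuousMap.dist_lt_iff hε).1 hdist x
  simpa [Real.dist_eq, ContinuousMap.sum_apply, ← hp, neuron, lin] using hx
end

section
/- Let K be a compact subset of ℝ^d, let σ : ℝ → ℝ be continuous and not equal to any polynomial, and let μ be a finite signed Borel measure on K. If ∫_K σ(⟨w, x⟩ + b) dμ(x) = 0 for every w ∈ ℝ^d and every b ∈ ℝ, then μ is the zero measure. -/
open scoped RealInnerProductSpace
open MeasureTheory
open scoped ContDiff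

open Filter Topology Polynomial in
/-- A smooth function whose `m`-th derivative vanishes is a polynomial of degree less than `m`. -/
theorem exists_polynomial_of_iteratedDeriv_eq_zero (m : ℕ) :
    ∀ f : ℝ → ℝ, ContDiff ℝ ∞ f → (∀ x, iteratedDeriv m f x = 0) →
      ∃ p : ℝ[X], p.degree < m ∧ ∀ x, f x = p.eval x := by
  induction m with
  | zero =>
    intro f _ h
    exact ⟨0, by simp, by simpa using h⟩
  | succ m ih =>
    intro f hf h
    obtain ⟨q, hq, hfq⟩ := ih (deriv f) ((contDiff_infty_iff_deriv.1 hf).2)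
      (fun x ↦ by rw [← iteratedDeriv_succ']; exact h x)
    set r : ℝ[X] := ∑ i ∈ Finset.range m, monomial (i + 1) (q.coeff i / (i + 1)) with hr
    have hr' : derivative r = q := by
      ext j
      simp only [hr, derivative_sum, derivative_monomial, finsetSum_coeff, coeff_monomial,
        Nat.add_sub_cancel, Finset.sum_ite_eq', Finset.mem_range]
      split_ifs with hj
      · push_cast
        field_simp
      · exact (coeff_eq_zero_of_degree_lt (hq.trans_le (by exact_mod_cast not_lt.1 hj))).symm
    refine ⟨r + C (f 0 - r.eval 0), ?_, fun x ↦ ?_⟩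
    · refine (degree_add_le _ _).trans_lt (max_lt ?_ ?_)
      · refine (degree_sum_le _ _).trans_lt ((Finset.sup_lt_iff (WithBot.bot_lt_coe _)).2 ?_)
        intro i hi
        refine (degree_monomial_le _ _).trans_lt ?_
        have := Finset.mem_range.1 hi
        exact_mod_cast Nat.succ_lt_succ this
      · exact degree_C_le.trans_lt (by exact_mod_cast Nat.succ_pos m)
    · have hd : Differentiable ℝ f := (contDiff_infty_iff_deriv.1 hf).1
      have := is_const_of_deriv_eq_zero (f := fun x ↦ f x - r.eval x)
        (hd.sub r.differentiable) (fun y ↦ by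
          rw [deriv_fun_sub (hd y) r.differentiableAt, Polynomial.deriv, hr', hfq, sub_self]) x 0
      simp only [eval_add, eval_C]
      linarith

open Filter Topology Polynomial in
/-- Pointwise limits of polynomial functions of degree less than `m` are such. -/
theorem exists_polynomial_of_tendsto {m : ℕ} {p : ℕ → ℝ[X]} (hp : ∀ n, (p n).degree < m)
    {f : ℝ → ℝ} (hf : ∀ x, Tendsto (fun n ↦ (p n).eval x) atTop (𝓝 (f x))) :
    ∃ q : ℝ[X], ∀ x, f x = q.eval x := by
  have hinj : Set.InjOn (fun i : ℕ ↦ (i : ℝ)) (Finset.range m) := Nat.cast_injective.injOn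
  refine ⟨Lagrange.interpolate (Finset.range m) (fun i : ℕ ↦ (i : ℝ)) fun i ↦ f i,
    fun x ↦ tendsto_nhds_unique (hf x) ?_⟩
  have h : ∀ n, (p n).eval x = (Lagrange.interpolate (Finset.range m) (fun i : ℕ ↦ (i : ℝ))
      fun i ↦ (p n).eval (i : ℝ)).eval x := fun n ↦ by
    rw [← Lagrange.eq_interpolate hinj (by simpa using hp n)]
  simp_rw [h, Lagrange.interpolate_apply, eval_finsetSum, eval_mul, eval_C]
  exact tendsto_finsetSum _ fun i _ ↦ (hf i).mul_const _

section Moments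

variable {X : Type*} [TopologicalSpace X] [CompactSpace X] [MeasurableSpace X] [BorelSpace X]

theorem hasDerivAt_integral_pow_mul {P : Measure X} [IsFiniteMeasure P] {u : X → ℝ}
    (hu : Continuous u) {g : ℝ → ℝ} (hg : ContDiff ℝ 1 g) (k : ℕ) (a b : ℝ) :
    HasDerivAt (fun a ↦ ∫ x, u x ^ k * g (a * u x + b) ∂P)
      (∫ x, u x ^ (k + 1) * deriv g (a * u x + b) ∂P) a := by
  have hg' : Continuous (deriv g) := hg.continuous_deriv le_rfl
  have hg₀ := hg.continuous
  obtain ⟨C, hC⟩ := ((isCompact_closedBall a 1).prod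
    (isCompact_univ (X := X))).exists_bound_of_continuousOn
    (f := fun q : ℝ × X ↦ u q.2 ^ (k + 1) * deriv g (q.1 * u q.2 + b)) (by fun_prop)
  refine (hasDerivAt_integral_of_dominated_loc_of_deriv_le
    (F := fun a x ↦ u x ^ k * g (a * u x + b))
    (F' := fun a x ↦ u x ^ (k + 1) * deriv g (a * u x + b)) (bound := fun _ ↦ C)
    (Metric.closedBall_mem_nhds a one_pos) (.of_forall fun a ↦ ?_) ?_ ?_ ?_ (integrable_const C)
    ?_).2
  · exact (Continuous.integrable_of_hasCompactSupport (by fun_prop) (.of_compactSpace _)).1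
  · exact Continuous.integrable_of_hasCompactSupport (by fun_prop) (.of_compactSpace _)
  · exact (Continuous.integrable_of_hasCompactSupport (by fun_prop) (.of_compactSpace _)).1
  · exact .of_forall fun x s hs ↦ hC (s, x) ⟨hs, trivial⟩
  · refine .of_forall fun x s _ ↦ ?_
    have h1 : HasDerivAt (fun s ↦ s * u x + b) (u x) s := by
      simpa using ((hasDerivAt_id s).mul_const (u x)).add_const b
    have h2 := ((hg.differentiable one_ne_zero _).hasDerivAt.comp s h1).const_mul (u x ^ k)
    rw [pow_succ, mul_assoc, mul_comm (u x)]
    exact h2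

variable {P N : Measure X} [IsFiniteMeasure P] [IsFiniteMeasure N] {u : X → ℝ}

theorem integral_pow_mul_iteratedDeriv_eq (hu : Continuous u) {g : ℝ → ℝ} (hg : ContDiff ℝ ∞ g)
    (h : ∀ a b, ∫ x, g (a * u x + b) ∂P = ∫ x, g (a * u x + b) ∂N) (k : ℕ) (a b : ℝ) :
    ∫ x, u x ^ k * iteratedDeriv k g (a * u x + b) ∂P =
      ∫ x, u x ^ k * iteratedDeriv k g (a * u x + b) ∂N := by
  induction k generalizing a with
  | zero => simpa using h a b
  | succ k ih =>
    have hk : ContDiff ℝ 1 (iteratedDeriv k g) := by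
      rw [iteratedDeriv_eq_iterate]
      exact ContDiff.iterate_deriv' 1 k (hg.of_le (by exact_mod_cast le_top))
    rw [iteratedDeriv_succ]
    refine (hasDerivAt_integral_pow_mul hu hk k a b).unique ?_
    rw [funext ih]
    exact hasDerivAt_integral_pow_mul hu hk k a b

open Convolution in
theorem integral_convolution_eq [R1Space X] (hu : Continuous u) {σ φ : ℝ → ℝ} (hσ : Continuous σ)
    (hφ : Continuous φ) (hφc : HasCompactSupport φ)
    (h : ∀ a b, ∫ x, σ (a * u x + b) ∂P = ∫ x, σ (a * u x + b) ∂N) (a b : ℝ) :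
    ∫ x, (φ ⋆[ContinuousLinearMap.lsmul ℝ ℝ, volume] σ) (a * u x + b) ∂P =
      ∫ x, (φ ⋆[ContinuousLinearMap.lsmul ℝ ℝ, volume] σ) (a * u x + b) ∂N := by
  have key : ∀ (Q : Measure X) [IsFiniteMeasure Q],
      ∫ x, (φ ⋆[ContinuousLinearMap.lsmul ℝ ℝ, volume] σ) (a * u x + b) ∂Q =
        ∫ t, φ t * ∫ x, σ (a * u x + (b - t)) ∂Q := by
    intro Q _
    simp only [convolution_def, ContinuousLinearMap.lsmul_apply, smul_eq_mul]
    rw [integral_integral_swap_of_hasCompactSupport]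
    · simp_rw [integral_const_mul, add_sub_assoc]
    · fun_prop
    · refine HasCompactSupport.intro (K := Set.univ ×ˢ tsupport φ)
        (isCompact_univ.prod hφc) fun q hq ↦ ?_
      have : q.2 ∉ tsupport φ := fun h ↦ hq ⟨trivial, h⟩
      exact mul_eq_zero_of_left (image_eq_zero_of_notMem_tsupport this) _
  rw [key P, key N]
  simp_rw [h]

open Filter Topology in
/-- If two finite measures on a compact space give the same integrals to all functions
`σ (a * u + b)` with `σ` continuous and non-polynomial, then `u` has the same moments with respect
to both. -/
theorem integral_pow_eq_of_integral_comp_affine_eq [R1Space X] (hu : Continuous u) {σ : ℝ → ℝ}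
    (hσ : Continuous σ) (hσ_nonpoly : ∀ p : Polynomial ℝ, ∃ x : ℝ, σ x ≠ p.eval x)
    (h : ∀ a b, ∫ x, σ (a * u x + b) ∂P = ∫ x, σ (a * u x + b) ∂N) (m : ℕ) :
    ∫ x, u x ^ m ∂P = ∫ x, u x ^ m ∂N := by
  by_contra hne
  let φ : ℕ → ContDiffBump (0 : ℝ) := fun n ↦
    ⟨1 / (n + 1 : ℝ) / 2, 1 / (n + 1 : ℝ), by positivity, half_lt_self (by positivity)⟩
  have hφ : Tendsto (fun n ↦ (φ n).rOut) atTop (𝓝 0) := tendsto_one_div_add_atTop_nhds_zero_nat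
  have hpoly : ∀ n, ∃ p : Polynomial ℝ, p.degree < m ∧ ∀ x,
      convolution ((φ n).normed volume) σ (ContinuousLinearMap.lsmul ℝ ℝ) volume x = p.eval x := by
    intro n
    have hg := (φ n).hasCompactSupport_normed (μ := volume).contDiff_convolution_left
      (ContinuousLinearMap.lsmul ℝ ℝ) ((φ n).contDiff_normed (n := ⊤))
      hσ.locallyIntegrable (μ := volume)
    refine exists_polynomial_of_iteratedDeriv_eq_zero m _ hg fun b ↦ ?_
    have := integral_pow_mul_iteratedDeriv_eq hu hg
      (integral_convolution_eq hu hσ (φ n).continuous_normed (φ n).hasCompactSupport_normed h) m 0 b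
    simp only [zero_mul, zero_add, integral_mul_const] at this
    by_contra h0
    exact hne (mul_right_cancel₀ h0 this)
  choose p hp hpe using hpoly
  obtain ⟨q, hq⟩ := exists_polynomial_of_tendsto hp (f := σ) fun x ↦ by
    simp_rw [← hpe]
    exact ContDiffBump.convolution_tendsto_right_of_continuous hφ hσ x
  obtain ⟨x, hx⟩ := hσ_nonpoly q
  exact hx (hq x)

theorem integral_cexp_eq_of_integral_pow_eq (hu : Continuous u)
    (h : ∀ m : ℕ, ∫ x, u x ^ m ∂P = ∫ x, u x ^ m ∂N) :
    ∫ x, Complex.exp (u x * Complex.I) ∂P = ∫ x, Complex.exp (u x * Complex.I) ∂N := by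
  obtain ⟨R, hR⟩ := (isCompact_univ (X := X)).exists_bound_of_continuousOn hu.continuousOn
  have key : ∀ (Q : Measure X) [IsFiniteMeasure Q],
      HasSum (fun m : ℕ ↦ Complex.I ^ m / m.factorial * ((∫ x, u x ^ m ∂Q : ℝ) : ℂ))
        (∫ x, Complex.exp (u x * Complex.I) ∂Q) := by
    intro Q _
    have := hasSum_integral_of_dominated_convergence (μ := Q)
      (F := fun (m : ℕ) x ↦ Complex.I ^ m / m.factorial * ((u x ^ m : ℝ) : ℂ))
      (f := fun x ↦ Complex.exp (u x * Complex.I))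
      (fun m _ ↦ R ^ m / m.factorial)
      (fun m ↦ (Continuous.integrable_of_hasCompactSupport (by fun_prop) (.of_compactSpace _)).1)
      (fun m ↦ .of_forall fun x ↦ ?_)
      (.of_forall fun _ ↦ Real.summable_pow_div_factorial R) (integrable_const _)
      (.of_forall fun x ↦ ?_)
    · simpa only [integral_const_mul, integral_complex_ofReal] using this
    · have := pow_le_pow_left₀ (norm_nonneg _) (hR x trivial) m
      simp only [norm_mul, norm_div, norm_pow, Complex.norm_I, one_pow, Complex.norm_natCast,
        Complex.norm_real]
      rw [one_div_mul_eq_div]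
      gcongr
    · have := NormedSpace.expSeries_div_hasSum_exp ((u x : ℂ) * Complex.I)
      rw [← Complex.exp_eq_exp_ℂ] at this
      simpa only [mul_pow, mul_comm, mul_div_assoc, Complex.ofReal_pow, mul_div_left_comm] using this
  refine (key P).unique ?_
  simp_rw [h]
  exact key N

end Moments

/-- Discriminatory property: if a finite signed Borel measure `μ` on a compact
`K ⊆ ℝ^d` annihilates `x ↦ σ(⟨w, x⟩ + b)` for all `w, b`, with `σ` continuous and
non-polynomial, then `μ = 0`. The integral against the signed measure is expressed
via its Jordan decomposition. -/
theorem discriminatory_annihilation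
    (d : ℕ) (K : Set (EuclideanSpace ℝ (Fin d))) (hK : IsCompact K)
    (σ : ℝ → ℝ) (hσ_cont : Continuous σ)
    (hσ_nonpoly : ∀ p : Polynomial ℝ, ∃ x : ℝ, σ x ≠ p.eval x)
    (μ : MeasureTheory.SignedMeasure K)
    (h : ∀ (w : EuclideanSpace ℝ (Fin d)) (b : ℝ),
      (∫ x : K, σ (⟪w, (x : EuclideanSpace ℝ (Fin d))⟫ + b)
          ∂μ.toJordanDecomposition.posPart) -
      (∫ x : K, σ (⟪w, (x : EuclideanSpace ℝ (Fin d))⟫ + b)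
          ∂μ.toJordanDecomposition.negPart) = 0) :
    μ = 0 := by
  have : CompactSpace K := isCompact_iff_compactSpace.1 hK
  have hv : MeasurableEmbedding ((↑) : K → EuclideanSpace ℝ (Fin d)) :=
    .subtype_coe hK.measurableSet
  set P := μ.toJordanDecomposition.posPart
  set N := μ.toJordanDecomposition.negPart
  have hPN : P = N := by
    refine hv.map_injective (Measure.ext_of_charFun (funext fun t ↦ ?_))
    rw [charFun_apply, charFun_apply, hv.integral_map, hv.integral_map]
    refine integral_cexp_eq_of_integral_pow_eq
      (u := fun x : K ↦ ⟪(x : EuclideanSpace ℝ (Fin d)), t⟫)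
      (by fun_prop) fun m ↦ ?_
    refine integral_pow_eq_of_integral_comp_affine_eq (by fun_prop) hσ_cont hσ_nonpoly
      (fun a b ↦ ?_) m
    simpa only [real_inner_smul_left, real_inner_comm _ t] using sub_eq_zero.1 (h (a • t) b)
  rw [← μ.toSignedMeasure_toJordanDecomposition, JordanDecomposition.toSignedMeasure]
  exact sub_eq_zero.2 (by simp only [show μ.toJordanDecomposition.posPart = _ from hPN]; rfl)
end

section
/- Let u ∈ ℝ^n be nonzero, let R be an S × n random matrix with independent entries each distributed according to the standard Gaussian measure on ℝ, and define v ∈ ℝ^S by v_i = (1/√S) ∑_{j=1}^n R_{ij} u_j. Let 0 < ε < 1 and let T ≥ 1 be a real number. If S (ε²/2 − ε³/3) ≥ 4 log T, then P( (1 − ε) ‖u‖₂² ≤ ‖v‖₂² ≤ (1 + ε) ‖u‖₂² ) ≥ 1 − 2/T². -/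
open MeasureTheory ProbabilityTheory

theorem Real.log_one_add_le_cubic {x : ℝ} (hx : -1 < x) :
    Real.log (1 + x) ≤ x - x ^ 2 / 2 + x ^ 3 / 3 := by
  let f : ℝ → ℝ := fun y ↦ y - y ^ 2 / 2 + y ^ 3 / 3 - Real.log (1 + y)
  have hd : ∀ y, -1 < y → HasDerivAt f (y ^ 3 / (1 + y)) y := by
    intro y hy
    have hy' : 1 + y ≠ 0 := by linarith
    convert! (((hasDerivAt_id y).sub (((hasDerivAt_id y).pow 2).div_const 2)).add
      (((hasDerivAt_id y).pow 3).div_const 3)).sub (((hasDerivAt_id y).const_add 1).log hy') using 1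
    simp only [id]
    field_simp
    ring
  suffices f 0 ≤ f x by simp [f] at this; linarith
  rcases le_total 0 x with h | h
  · refine monotoneOn_of_deriv_nonneg (convex_Ici 0) (fun y hy ↦ ?_) (fun y hy ↦ ?_) (fun y hy ↦ ?_)
      Set.self_mem_Ici h h
    · exact (hd y (by linarith [Set.mem_Ici.1 hy])).continuousAt.continuousWithinAt
    all_goals
      rw [interior_Ici, Set.mem_Ioi] at hy
    · exact (hd y (by linarith)).differentiableAt.differentiableWithinAt
    · rw [(hd y (by linarith)).deriv]
      positivity
  · refine antitoneOn_of_deriv_nonpos (convex_Ioc (-1) 0) (fun y hy ↦ ?_) (fun y hy ↦ ?_)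
      (fun y hy ↦ ?_) ⟨hx, h⟩ ⟨by norm_num, le_rfl⟩ h
    · exact (hd y hy.1).continuousAt.continuousWithinAt
    all_goals
      rw [interior_Ioc] at hy
    · exact (hd y hy.1).differentiableAt.differentiableWithinAt
    · rw [(hd y hy.1).deriv]
      exact div_nonpos_of_nonpos_of_nonneg (Odd.pow_nonpos (by decide) hy.2.le) (by linarith [hy.1])

namespace ProbabilityTheory

theorem gaussianPDFReal_smul_exp_mul_sq (t x : ℝ) :
    gaussianPDFReal 0 1 x • Real.exp (t * x ^ 2) =
      (√(2 * Real.pi))⁻¹ * Real.exp (-(1 / 2 - t) * x ^ 2) := by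
  simp only [gaussianPDFReal, NNReal.coe_one, mul_one, sub_zero, smul_eq_mul, mul_assoc,
    ← Real.exp_add]
  ring_nf

theorem integral_exp_mul_sq_gaussianReal {t : ℝ} (ht : t < 1 / 2) :
    ∫ x, Real.exp (t * x ^ 2) ∂gaussianReal 0 1 = (√(1 - 2 * t))⁻¹ := by
  rw [integral_gaussianReal_eq_integral_smul one_ne_zero]
  simp_rw [gaussianPDFReal_smul_exp_mul_sq]
  rw [integral_const_mul, integral_gaussian, ← Real.sqrt_inv, ← Real.sqrt_inv,
    ← Real.sqrt_mul (by positivity)]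
  congr 1
  have : 1 - 2 * t ≠ 0 := by linarith
  have : 1 / 2 - t ≠ 0 := by linarith
  field_simp

theorem integrable_exp_mul_sq_gaussianReal {t : ℝ} (ht : t < 1 / 2) :
    Integrable (fun x ↦ Real.exp (t * x ^ 2)) (gaussianReal 0 1) := by
  refine Integrable.of_integral_ne_zero ?_
  rw [integral_exp_mul_sq_gaussianReal ht]
  have : 0 < 1 - 2 * t := by linarith
  positivity

theorem map_pi_gaussianReal_sum_mul {ι : Type*} [Fintype ι] {w : ι → ℝ} (hw : ∑ j, w j ^ 2 = 1) :
    (Measure.pi fun _ : ι ↦ gaussianReal 0 1).map (fun x ↦ ∑ j, x j * w j) = gaussianReal 0 1 := by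
  have hm : Measurable fun x : ι → ℝ ↦ ∑ j, x j * w j := by fun_prop
  have : IsProbabilityMeasure
      ((Measure.pi fun _ : ι ↦ gaussianReal 0 1).map (fun x ↦ ∑ j, x j * w j)) :=
    Measure.isProbabilityMeasure_map hm.aemeasurable
  refine Measure.ext_of_charFun (funext fun t ↦ ?_)
  have hj (j : ι) : charFun (gaussianReal 0 1) (t * w j) =
      Complex.exp (-((t ^ 2 * w j ^ 2 / 2 : ℝ) : ℂ)) := by
    rw [charFun_gaussianReal]
    congr 1
    push_cast
    ring
  have hpi : charFun ((Measure.pi fun _ : ι ↦ gaussianReal 0 1).map (fun x ↦ ∑ j, x j * w j)) t =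
      ∏ j, charFun (gaussianReal 0 1) (t * w j) := by
    rw [charFun_apply_real, integral_map hm.aemeasurable (by fun_prop)]
    simp_rw [charFun_apply_real]
    rw [← integral_fintype_prod_eq_prod]
    congr 1 with x
    rw [← Complex.exp_sum]
    congr 1
    push_cast
    rw [Finset.mul_sum, Finset.sum_mul]
    exact Finset.sum_congr rfl fun j _ ↦ by ring
  rw [hpi, charFun_gaussianReal]
  simp_rw [hj]
  rw [← Complex.exp_sum, Finset.sum_neg_distrib, ← Complex.ofReal_sum, ← Finset.sum_div,
    ← Finset.mul_sum, hw]
  congr 1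
  push_cast
  ring

variable {Ω ι : Type*} [Fintype ι] {mΩ : MeasurableSpace Ω} {μ : Measure Ω} {X : ι → Ω → ℝ}

/-- Exponential moment bound behind both Chernoff tails of a chi-squared variable with `Fintype.card ι` degrees of freedom. -/
theorem exp_mul_mgf_sum_sq_gaussianReal_le (hind : iIndepFun X μ) (hm : ∀ i, Measurable (X i))
    (hX : ∀ i, μ.map (X i) = gaussianReal 0 1) {x : ℝ} (hx : -1 < x) :
    Integrable (fun ω ↦ Real.exp (x / (2 * (1 + x)) * ∑ i, X i ω ^ 2)) μ ∧
    Real.exp (-(x / (2 * (1 + x))) * ((1 + x) * Fintype.card ι)) *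
      mgf (fun ω ↦ ∑ i, X i ω ^ 2) μ (x / (2 * (1 + x))) ≤
      Real.exp (-(Fintype.card ι * (x ^ 2 / 2 - x ^ 3 / 3)) / 2) := by
  have h1 : 0 < 1 + x := by linarith
  set t := x / (2 * (1 + x)) with ht_def
  have htx : 1 - 2 * t = (1 + x)⁻¹ := by rw [ht_def]; field_simp; ring
  have ht : t < 1 / 2 := by
    have : 0 < (1 + x)⁻¹ := by positivity
    linarith
  have : IsProbabilityMeasure μ := hind.isProbabilityMeasure
  have hsum : (fun ω ↦ ∑ i, X i ω ^ 2) = ∑ i, fun ω ↦ X i ω ^ 2 := by ext ω; simp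
  have hind' : iIndepFun (fun i ω ↦ X i ω ^ 2) μ :=
    hind.comp (fun _ y ↦ y ^ 2) (fun _ ↦ by fun_prop)
  have hm' (i : ι) : Measurable fun ω ↦ X i ω ^ 2 := (hm i).pow_const 2
  have hint (i : ι) : Integrable (fun ω ↦ Real.exp (t * X i ω ^ 2)) μ := by
    have := integrable_exp_mul_sq_gaussianReal ht
    rw [← hX i] at this
    exact this.comp_measurable (hm i)
  have hmgf (i : ι) : mgf (fun ω ↦ X i ω ^ 2) μ t = Real.exp (Real.log (1 + x) / 2) := by
    have := integral_exp_mul_sq_gaussianReal ht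
    rw [← hX i, integral_map (hm i).aemeasurable (by fun_prop), htx, Real.sqrt_inv, inv_inv] at this
    rw [mgf, this, Real.exp_half, Real.exp_log h1]
  refine ⟨?_, ?_⟩
  · simpa using hind'.integrable_exp_mul_sum hm' (s := Finset.univ) (t := t) fun i _ ↦ hint i
  · rw [hsum, hind'.mgf_sum hm']
    simp_rw [hmgf]
    rw [Finset.prod_const, ← Real.exp_nat_mul, ← Real.exp_add, Finset.card_univ]
    refine Real.exp_le_exp.2 ?_
    have htx' : t * (1 + x) = x / 2 := by rw [ht_def]; field_simp
    have := mul_le_mul_of_nonneg_left (Real.log_one_add_le_cubic hx)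
      (Nat.cast_nonneg (α := ℝ) (Fintype.card ι))
    linear_combination this / 2 - Fintype.card ι * htx'

theorem measureReal_le_sum_sq_gaussianReal_le (hind : iIndepFun X μ) (hm : ∀ i, Measurable (X i))
    (hX : ∀ i, μ.map (X i) = gaussianReal 0 1) {x : ℝ} (hx : 0 ≤ x) :
    μ.real {ω | (1 + x) * Fintype.card ι ≤ ∑ i, X i ω ^ 2} ≤
      Real.exp (-(Fintype.card ι * (x ^ 2 / 2 - x ^ 3 / 3)) / 2) := by
  have : IsProbabilityMeasure μ := hind.isProbabilityMeasure
  obtain ⟨hint, hle⟩ := exp_mul_mgf_sum_sq_gaussianReal_le hind hm hX (by linarith : -1 < x)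
  exact (measure_ge_le_exp_mul_mgf _ (by positivity) hint).trans hle

theorem measureReal_sum_sq_gaussianReal_le_le (hind : iIndepFun X μ) (hm : ∀ i, Measurable (X i))
    (hX : ∀ i, μ.map (X i) = gaussianReal 0 1) {x : ℝ} (hx : 0 ≤ x) (hx' : x < 1) :
    μ.real {ω | ∑ i, X i ω ^ 2 ≤ (1 - x) * Fintype.card ι} ≤
      Real.exp (-(Fintype.card ι * (x ^ 2 / 2 - x ^ 3 / 3)) / 2) := by
  have : IsProbabilityMeasure μ := hind.isProbabilityMeasure
  obtain ⟨hint, hle⟩ := exp_mul_mgf_sum_sq_gaussianReal_le hind hm hX (by linarith : -1 < -x)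
  rw [← sub_eq_add_neg] at hint hle
  refine (measure_le_le_exp_mul_mgf _
    (div_nonpos_of_nonpos_of_nonneg (by linarith) (by linarith)) hint).trans (hle.trans ?_)
  refine Real.exp_le_exp.2 ?_
  have : 0 ≤ (Fintype.card ι : ℝ) * x ^ 3 := by positivity
  linear_combination this / 3

end ProbabilityTheory

/-- Johnson–Lindenstrauss-type norm preservation: if `R` is an `S × n` random
matrix with i.i.d. standard Gaussian entries, `u ≠ 0`, `v = (1/√S) R u`,
`0 < ε < 1`, `T ≥ 1` and `S (ε²/2 − ε³/3) ≥ 4 log T`, then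
`(1−ε)‖u‖² ≤ ‖v‖² ≤ (1+ε)‖u‖²` with probability at least `1 − 2/T²`. -/
theorem jl_norm_preservation
    {Ω : Type*} [MeasureSpace Ω] [IsProbabilityMeasure (ℙ : Measure Ω)]
    (S n : ℕ) (R : Ω → Fin S → Fin n → ℝ) (hRm : Measurable R)
    (hRdist : Measure.map R ℙ =
      Measure.pi fun _ : Fin S => Measure.pi fun _ : Fin n => gaussianReal 0 1)
    (u : EuclideanSpace ℝ (Fin n)) (hu : u ≠ 0)
    (v : Ω → Fin S → ℝ)
    (hv : ∀ ω i, v ω i = (1 / Real.sqrt S) * ∑ j : Fin n, R ω i j * u j)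
    (ε : ℝ) (hε₀ : 0 < ε) (hε₁ : ε < 1)
    (T : ℝ) (hT : 1 ≤ T)
    (hS : 4 * Real.log T ≤ S * (ε ^ 2 / 2 - ε ^ 3 / 3)) :
    1 - 2 / T ^ 2 ≤
      (ℙ {ω | (1 - ε) * ‖u‖ ^ 2 ≤ ∑ i : Fin S, v ω i ^ 2 ∧
              ∑ i : Fin S, v ω i ^ 2 ≤ (1 + ε) * ‖u‖ ^ 2}).toReal := by
  rcases S.eq_zero_or_pos with rfl | hSpos
  · have hlog : Real.log T ≤ 0 := by simp at hS; linarith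
    have hT1 : T = 1 := le_antisymm ((Real.log_nonpos_iff (by linarith)).1 hlog) hT
    rw [hT1]
    exact le_trans (by norm_num) ENNReal.toReal_nonneg
  have hSR : (0 : ℝ) < S := by exact_mod_cast hSpos
  have hu' : 0 < ‖u‖ := norm_pos_iff.2 hu
  have hw : ∑ j, (u j / ‖u‖) ^ 2 = 1 := by
    simp_rw [div_pow]
    rw [← Finset.sum_div, ← EuclideanSpace.real_norm_sq_eq, div_self (by positivity)]
  let X : Fin S → Ω → ℝ := fun i ω ↦ ∑ j, R ω i j * (u j / ‖u‖)
  have hm (i : Fin S) : Measurable (X i) := by fun_prop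
  have hrow (i : Fin S) : Measure.map (fun ω ↦ R ω i) ℙ =
      Measure.pi fun _ : Fin n ↦ gaussianReal 0 1 := by
    have := congrArg (Measure.map (Function.eval i)) hRdist
    rwa [Measure.map_map (by fun_prop) hRm, (measurePreserving_eval _ i).map_eq] at this
  have hX (i : Fin S) : Measure.map (X i) ℙ = gaussianReal 0 1 := by
    rw [← map_pi_gaussianReal_sum_mul hw, ← hrow i, Measure.map_map (by fun_prop) (by fun_prop)]
    rfl
  have hind : iIndepFun X ℙ := by
    have hR : iIndepFun (fun i ω ↦ R ω i) ℙ := by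
      rw [iIndepFun_iff_map_fun_eq_pi_map (by fun_prop)]
      simp_rw [hrow]
      exact hRdist
    exact hR.comp (fun _ r ↦ ∑ j, r j * (u j / ‖u‖)) (fun _ ↦ by fun_prop)
  have hvX (ω : Ω) : ∑ i, v ω i ^ 2 = ‖u‖ ^ 2 / S * ∑ i, X i ω ^ 2 := by
    rw [Finset.mul_sum]
    refine Finset.sum_congr rfl fun i _ ↦ ?_
    have : X i ω = (∑ j, R ω i j * u j) / ‖u‖ := by
      simp_rw [X, Finset.sum_div, mul_div_assoc]
    rw [hv, this, mul_pow, div_pow, div_pow, Real.sq_sqrt hSR.le]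
    field_simp
  have hexp : Real.exp (-(S * (ε ^ 2 / 2 - ε ^ 3 / 3)) / 2) ≤ 1 / T ^ 2 := by
    have hT0 : 0 < T := by linarith
    rw [← Real.exp_log (by positivity : 0 < 1 / T ^ 2)]
    refine Real.exp_le_exp.2 ?_
    rw [one_div, Real.log_inv, Real.log_pow]
    push_cast
    linarith
  have hup := measureReal_le_sum_sq_gaussianReal_le hind hm hX hε₀.le
  have hlo := measureReal_sum_sq_gaussianReal_le_le hind hm hX hε₀.le hε₁
  rw [Fintype.card_fin] at hup hlo
  set A := {ω | (1 - ε) * ‖u‖ ^ 2 ≤ ∑ i : Fin S, v ω i ^ 2 ∧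
    ∑ i : Fin S, v ω i ^ 2 ≤ (1 + ε) * ‖u‖ ^ 2}
  have hcover : (Set.univ : Set Ω) ⊆ A ∪ ({ω | (1 + ε) * S ≤ ∑ i, X i ω ^ 2} ∪
      {ω | ∑ i, X i ω ^ 2 ≤ (1 - ε) * S}) := by
    intro ω _
    by_contra! h
    simp only [Set.mem_union, Set.mem_ofPred_eq, not_or, not_le] at h
    obtain ⟨hA, h1, h2⟩ := h
    refine hA ?_
    have hc : 0 < ‖u‖ ^ 2 / S := by positivity
    have key (a : ℝ) : a * ‖u‖ ^ 2 = ‖u‖ ^ 2 / S * (a * S) := by field_simp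
    simp only [A, Set.mem_ofPred_eq, hvX, key]
    exact ⟨by gcongr, by gcongr⟩
  have hone : 1 ≤ (ℙ : Measure Ω).real A + (1 / T ^ 2 + 1 / T ^ 2) := calc
    1 = (ℙ : Measure Ω).real Set.univ := probReal_univ.symm
    _ ≤ _ := measureReal_mono hcover
    _ ≤ _ := measureReal_union_le _ _
    _ ≤ _ := by
      gcongr
      exact (measureReal_union_le _ _).trans (add_le_add (hup.trans hexp) (hlo.trans hexp))
  change _ ≤ (ℙ : Measure Ω).real A
  linear_combination hone
end
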